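/- Let q be a prime, G a commutative group of order q, and h, h₁, …, h_N ∈ G. Let U ∈ (ZMod q)^{N×N} be invertible with inverse A, c ∈ G^N, U' ∈ (ZMod q)^{N×N}, r̃ ∈ (ZMod q)^N, r̄ ∈ ZMod q, and suppose ∏_{i=1}^N c_i^{U_{i,j}} = EPC(U'_j, r̃_j) for every j, and ∏_{i=1}^N c_i = EPC(𝟏, r̄). Set M = U'A. If M𝟏 ≠ 𝟏, then EPC(𝟏, r̄) = EPC(M𝟏, Σ_{l=1}^N ⟨r̃, A_l⟩) with 𝟏 ≠ M𝟏; that is, one obtains two openings of the same extended Pedersen commitment to distinct messages (a witness to the relation R_com breaking the binding of the commitment scheme). -/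

import Mathlib

/-- Exponentiation of a monoid element by an element of `ZMod n`. -/
instance (priority := low) monoidZModPow {M : Type*} [Monoid M] {n : ℕ} :
    Pow M (ZMod n) := ⟨fun g x => g ^ x.val⟩

/-- The extended Pedersen commitment `EPC(m, r) = h^r ∏ i, hᵢ^(mᵢ)`. -/
def EPC {G : Type*} [CommGroup G] {q N : ℕ} (h : G) (hs : Fin N → G)
    (m : Fin N → ZMod q) (r : ZMod q) : G :=
  h ^ r * ∏ i, hs i ^ m i

theorem zmod_pow_def {M : Type*} [Monoid M] {n : ℕ} (g : M) (x : ZMod n) :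
    g ^ x = g ^ x.val := rfl

theorem zmod_pow_zero {M : Type*} [Monoid M] {n : ℕ} (g : M) : g ^ (0 : ZMod n) = 1 := by
  rw [zmod_pow_def, ZMod.val_zero, pow_zero]

theorem zmod_pow_one {M : Type*} [Monoid M] {n : ℕ} [Fact (1 < n)] (g : M) :
    g ^ (1 : ZMod n) = g := by
  rw [zmod_pow_def, ZMod.val_one, pow_one]

theorem zmod_pow_add {M : Type*} [Monoid M] {n : ℕ} [NeZero n] {g : M} (hg : g ^ n = 1)
    (x y : ZMod n) : g ^ (x + y) = g ^ x * g ^ y := by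
  rw [zmod_pow_def, zmod_pow_def, zmod_pow_def, ZMod.val_add, ← pow_add, ← pow_eq_pow_mod _ hg]

theorem zmod_pow_mul {M : Type*} [Monoid M] {n : ℕ} {g : M} (hg : g ^ n = 1)
    (x y : ZMod n) : g ^ (x * y) = (g ^ x) ^ y := by
  rw [zmod_pow_def, zmod_pow_def, zmod_pow_def, ZMod.val_mul, ← pow_mul, ← pow_eq_pow_mod _ hg]

theorem zmod_pow_sum {M ι : Type*} [CommMonoid M] {n : ℕ} [NeZero n] {g : M} (hg : g ^ n = 1)
    (s : Finset ι) (x : ι → ZMod n) : g ^ (∑ i ∈ s, x i) = ∏ i ∈ s, g ^ x i := by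
  classical
  induction s using Finset.induction_on with
  | empty => simp [zmod_pow_zero]
  | insert i s hi ih => rw [Finset.sum_insert hi, Finset.prod_insert hi, zmod_pow_add hg, ih]

theorem prod_zmod_pow {M ι : Type*} [CommMonoid M] {n : ℕ} (s : Finset ι) (f : ι → M)
    (x : ZMod n) : (∏ i ∈ s, f i) ^ x = ∏ i ∈ s, f i ^ x :=
  (Finset.prod_pow s x.val f).symm

section EPC

variable {G : Type*} [CommGroup G] {q N : ℕ}

theorem EPC_zmod_pow (hexp : ∀ g : G, g ^ q = 1) (h : G) (hs : Fin N → G)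
    (m : Fin N → ZMod q) (r a : ZMod q) :
    EPC h hs m r ^ a = EPC h hs (fun i => m i * a) (r * a) := by
  simp only [EPC, zmod_pow_mul (hexp _), ← prod_zmod_pow]
  exact mul_pow _ _ a.val

theorem prod_EPC [NeZero q] (hexp : ∀ g : G, g ^ q = 1) {ι : Type*} (s : Finset ι) (h : G)
    (hs : Fin N → G) (m : ι → Fin N → ZMod q) (r : ι → ZMod q) :
    ∏ j ∈ s, EPC h hs (m j) (r j) = EPC h hs (fun i => ∑ j ∈ s, m j i) (∑ j ∈ s, r j) := by
  simp only [EPC, zmod_pow_sum (hexp _), Finset.prod_mul_distrib]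
  rw [Finset.prod_comm]

/-- Multiplying by a right inverse of the exponent matrix recovers the individual elements. -/
theorem prod_prod_zmod_pow_eq [Fact (1 < q)] (hexp : ∀ g : G, g ^ q = 1) {ι : Type*} [Fintype ι]
    [DecidableEq ι] {U A : Matrix ι ι (ZMod q)} (hUA : U * A = 1) (c : ι → G) (l : ι) :
    ∏ j, (∏ i, c i ^ U i j) ^ A j l = c l := by
  have : NeZero q := ⟨(zero_lt_one.trans (Fact.out : 1 < q)).ne'⟩
  simp only [prod_zmod_pow, ← zmod_pow_mul (hexp _)]
  rw [Finset.prod_comm]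
  simp only [← zmod_pow_sum (hexp _), ← Matrix.mul_apply, hUA]
  rw [Finset.prod_eq_single l]
  · rw [Matrix.one_apply_eq, zmod_pow_one]
  · intro i _ hi
    rw [Matrix.one_apply_ne hi, zmod_pow_zero]
  · simp

end EPC

theorem stmt_13 {q : ℕ} [Fact (Nat.Prime q)] {G : Type*} [CommGroup G] [Fintype G]
    (hcard : Fintype.card G = q) {N : ℕ} (h : G) (hs : Fin N → G)
    (U A : Matrix (Fin N) (Fin N) (ZMod q)) (hUA : U * A = 1) (hAU : A * U = 1)
    (cvec : Fin N → G) (U' : Matrix (Fin N) (Fin N) (ZMod q)) (rt : Fin N → ZMod q)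
    (rbar : ZMod q)
    (hopen : ∀ j, ∏ i, cvec i ^ U i j = EPC h hs (fun i => U' i j) (rt j))
    (hones : ∏ i, cvec i = EPC h hs 1 rbar)
    (M : Matrix (Fin N) (Fin N) (ZMod q)) (hMdef : M = U' * A)
    (hM1 : M.mulVec 1 ≠ 1) :
    EPC h hs 1 rbar = EPC h hs (M.mulVec 1) (∑ l, ∑ j, rt j * A j l) ∧
      (1 : Fin N → ZMod q) ≠ M.mulVec 1 := by
  have : Fact (1 < q) := ⟨(Fact.out : q.Prime).one_lt⟩
  have hexp : ∀ g : G, g ^ q = 1 := fun g => hcard ▸ pow_card_eq_one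
  have hc : ∀ l, cvec l = EPC h hs (fun i => M i l) (∑ j, rt j * A j l) := by
    intro l
    rw [← prod_prod_zmod_pow_eq hexp hUA cvec l]
    simp only [hopen, EPC_zmod_pow hexp, prod_EPC hexp, hMdef, Matrix.mul_apply]
  refine ⟨?_, hM1.symm⟩
  rw [← hones, Finset.prod_congr rfl fun l _ => hc l, prod_EPC hexp]
  congr 1
  ext i
  simp [Matrix.mulVec, dotProduct]
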